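/- arXiv:1002.3840 — 6 statements merged into one kernel-verified Lean document; each statement's English description precedes it below -/
import Mathlib

section
/- Let p and q be odd prime numbers. If p² divides the Mersenne number M_q = 2^q − 1, then p² divides 2^(p−1) − 1, i.e., p is a Wieferich prime. -/
/-- If `p, q` are odd primes and `p^2` divides the Mersenne number `M_q = 2^q - 1`,
then `p^2` divides `2^(p-1) - 1`, i.e. `p` is a Wieferich prime. -/
theorem stmt3 (p q : ℕ) (hp : p.Prime) (hq : q.Prime) (hpodd : Odd p) (hqodd : Odd q)
    (hdvd : p ^ 2 ∣ 2 ^ q - 1) :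
    p ^ 2 ∣ 2 ^ (p - 1) - 1 := by
  have h1 : p ∣ 2 ^ q - 1 := (dvd_pow_self p two_ne_zero).trans hdvd
  have hc : Nat.Coprime 2 p := hpodd.coprime_two_left
  have h2 : p ∣ 2 ^ (p - 1) - 1 := by
    have h := Nat.ModEq.pow_totient hc
    rw [Nat.totient_prime hp] at h
    exact (Nat.modEq_iff_dvd' Nat.one_le_two_pow).1 h.symm
  have h3 : p ∣ 2 ^ (Nat.gcd q (p - 1)) - 1 := by
    rw [← Nat.pow_sub_one_gcd_pow_sub_one]
    exact Nat.dvd_gcd h1 h2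
  have h4 : q ∣ p - 1 := by
    by_contra hn
    rw [(Nat.Prime.coprime_iff_not_dvd hq).2 hn] at h3
    exact hp.one_lt.ne' (Nat.dvd_one.1 (by simpa using h3))
  exact hdvd.trans (Nat.pow_sub_one_dvd_pow_sub_one 2 h4)
end

section
/- Let p > 7 be a prime number with p ≡ 3 (mod 4). Then q = 2p + 1 is a prime number if and only if 2^p ≡ 1 (mod q). -/
/-- Let `p > 7` be a prime with `p ≡ 3 (mod 4)`. Then `q = 2p + 1` is prime if and only
if `2^p ≡ 1 (mod q)`. -/
theorem stmt4 (p : ℕ) (hp : p.Prime) (hp7 : 7 < p) (hp4 : p % 4 = 3) :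
    (2 * p + 1).Prime ↔ 2 ^ p ≡ 1 [MOD 2 * p + 1] := by
  constructor
  · intro hq
    haveI := Fact.mk hq
    have h2 : (2 : ZMod (2 * p + 1)) ≠ 0 := by
      intro h
      have h' : ((2 : ℕ) : ZMod (2 * p + 1)) = 0 := by exact_mod_cast h
      rw [ZMod.natCast_eq_zero_iff] at h'
      have := Nat.le_of_dvd (by norm_num) h'
      omega
    have hs : IsSquare (2 : ZMod (2 * p + 1)) :=
      (ZMod.exists_sq_eq_two_iff (by omega)).2 (by omega)
    have h := (ZMod.euler_criterion (2 * p + 1) h2).1 hs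
    rw [show (2 * p + 1) / 2 = p by omega] at h
    rw [← ZMod.natCast_eq_natCast_iff]
    push_cast
    exact h
  · intro h
    have hr : (2 * p + 1).minFac.Prime := Nat.minFac_prime (by omega)
    have hd : (2 * p + 1).minFac ∣ 2 * p + 1 := Nat.minFac_dvd _
    generalize (2 * p + 1).minFac = r at hr hd
    haveI := Fact.mk hr
    haveI := Fact.mk hp
    have h1 : (2 : ZMod r) ^ p = 1 := by
      have := (ZMod.natCast_eq_natCast_iff _ _ _).2 (h.of_dvd hd)
      simpa using this
    have hne1 : (2 : ZMod r) ≠ 1 := by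
      intro h
      have h3 : (1 : ZMod r) + 1 = 1 := by rw [one_add_one_eq_two]; exact h
      simp at h3
    have hne0 : (2 : ZMod r) ≠ 0 := by
      intro h
      rw [h, zero_pow hp.ne_zero] at h1
      exact zero_ne_one h1
    have ho : orderOf (2 : ZMod r) = p := orderOf_eq_prime h1 hne1
    have hdv : p ∣ r - 1 := by
      rw [← ho]
      exact orderOf_dvd_of_pow_eq_one (ZMod.pow_card_sub_one_eq_one hne0)
    have hle := Nat.le_of_dvd (by have := hr.two_le; omega) hdv
    obtain ⟨k, hk⟩ := hd
    have hk2 : k < 2 := by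
      by_contra hc
      have : r * 2 ≤ r * k := Nat.mul_le_mul_left r (by omega)
      omega
    interval_cases k
    · omega
    · rw [hk, mul_one]; exact hr
end

section
/- Let p be a prime number with p ≡ 3 (mod 4) such that q = 2p + 1 is also prime. Then q is the smallest prime divisor of the Mersenne number M_p = 2^p − 1; that is, q divides M_p and every prime divisor r of M_p satisfies r ≥ q. -/
lemma dvd_iff_zmod_pow (p r : ℕ) : r ∣ 2 ^ p - 1 ↔ (2 : ZMod r) ^ p = 1 := by
  rw [← ZMod.natCast_eq_zero_iff, Nat.cast_sub Nat.one_le_two_pow]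
  push_cast
  exact sub_eq_zero

/-- Let `p ≡ 3 (mod 4)` be a Sophie Germain prime and `q = 2p+1`. Then `q` is the
smallest prime divisor of `M_p = 2^p - 1`. -/
theorem stmt9 (p q : ℕ) (hp : p.Prime) (hp4 : p % 4 = 3) (hq : q = 2 * p + 1)
    (hqprime : q.Prime) :
    q ∣ 2 ^ p - 1 ∧ ∀ r : ℕ, r.Prime → r ∣ 2 ^ p - 1 → q ≤ r := by
  have two_ne : ∀ r : ℕ, r.Prime → r ≠ 2 → (2 : ZMod r) ≠ 0 := by
    intro r hr h2 h
    have h' : ((2 : ℕ) : ZMod r) = 0 := by exact_mod_cast h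
    rw [ZMod.natCast_eq_zero_iff] at h'
    exact h2 ((Nat.prime_dvd_prime_iff_eq hr Nat.prime_two).1 h')
  constructor
  · haveI := Fact.mk hqprime
    have hq2 : q ≠ 2 := by omega
    have hs : IsSquare (2 : ZMod q) :=
      (ZMod.exists_sq_eq_two_iff hq2).2 (Or.inr (by omega))
    have h := (ZMod.euler_criterion q (two_ne q hqprime hq2)).1 hs
    rw [dvd_iff_zmod_pow]
    rwa [show q / 2 = p by omega] at h
  · intro r hr hd
    haveI := Fact.mk hr
    have hr2 : r ≠ 2 := by
      rintro rfl
      have h1 : 2 ∣ 2 ^ p := dvd_pow_self 2 hp.ne_zero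
      have h3 := Nat.one_le_two_pow (n := p)
      omega
    haveI := Fact.mk hp
    rw [dvd_iff_zmod_pow] at hd
    have hne : (2 : ZMod r) ≠ 1 := by
      intro h
      have : (1 : ZMod r) = 0 := by linear_combination h
      exact one_ne_zero this
    have ho : orderOf (2 : ZMod r) = p := orderOf_eq_prime hd hne
    have hdv : p ∣ r - 1 := by
      rw [← ho]
      exact orderOf_dvd_of_pow_eq_one (ZMod.pow_card_sub_one_eq_one (two_ne r hr hr2))
    have hodd := hr.eq_two_or_odd.resolve_left hr2
    have hr1 := hr.two_le
    have h2p : 2 * p ∣ r - 1 :=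
      Nat.Coprime.mul_dvd_of_dvd_of_dvd
        ((Nat.coprime_two_left).2 (Nat.odd_iff.2 (by omega))) (by omega) hdv
    have := Nat.le_of_dvd (by omega) h2p
    omega
end

section
/- Let p be a prime number with p ≡ 3 (mod 4) such that q = 2p + 1 is also prime. Then the multiplicative order of −2 modulo q equals 2p = q − 1; that is, −2 is a primitive root modulo q and generates the cyclic group (ℤ/qℤ)*. -/
/-- Let `p ≡ 3 (mod 4)` be a Sophie Germain prime and `q = 2p+1`. Then `-2` has
multiplicative order `2p = q - 1` modulo `q`, i.e. `-2` is a primitive root mod `q`. -/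
theorem stmt11 (p q : ℕ) (hp : p.Prime) (hp4 : p % 4 = 3) (hq : q = 2 * p + 1)
    (hqprime : q.Prime) :
    orderOf ((-2 : ZMod q)) = 2 * p := by
  haveI : Fact q.Prime := ⟨hqprime⟩
  have hsmall : ∀ n : ℕ, 0 < n → n < 7 → (n : ZMod q) ≠ 0 := by
    intro n h0 h7 h
    have := Nat.le_of_dvd h0 ((ZMod.natCast_eq_zero_iff n q).1 h)
    omega
  have h2 : (-2 : ZMod q) ≠ 0 := by
    have := hsmall 2 (by norm_num) (by norm_num)
    exact neg_ne_zero.2 (by exact_mod_cast this)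
  have h3 : (3 : ZMod q) ≠ 0 := by
    exact_mod_cast hsmall 3 (by norm_num) (by norm_num)
  apply orderOf_eq_of_pow_and_pow_div_prime (by omega)
  · have := ZMod.pow_card_sub_one_eq_one h2
    rwa [show q - 1 = 2 * p by omega] at this
  · intro r hr hd
    rcases (Nat.Prime.dvd_mul hr).1 hd with h | h
    · rw [(Nat.prime_dvd_prime_iff_eq hr Nat.prime_two).1 h,
        show 2 * p / 2 = q / 2 by omega]
      intro h1
      have := (ZMod.exists_sq_eq_neg_two_iff (p := q) (by omega)).1
        ((ZMod.euler_criterion q h2).2 h1)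
      omega
    · rw [(Nat.prime_dvd_prime_iff_eq hr hp).1 h, Nat.mul_div_cancel _ hp.pos]
      intro h1
      apply h3
      linear_combination h1
end

section
/- Let p be a prime number with p ≡ 3 (mod 4) such that q = 2p + 1 is also prime. If q² divides 2^p − 1, then the multiplicative order of −2 modulo q² equals 2p. -/
/-- Let `p ≡ 3 (mod 4)` be a Sophie Germain prime and `q = 2p+1`. If `q^2 ∣ 2^p - 1`,
then `-2` has multiplicative order `2p` modulo `q^2`. -/
theorem stmt12 (p q : ℕ) (hp : p.Prime) (hp4 : p % 4 = 3) (hq : q = 2 * p + 1)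
    (hqprime : q.Prime) (hdvd : q ^ 2 ∣ 2 ^ p - 1) :
    orderOf ((-2 : ZMod (q ^ 2))) = 2 * p := by
  haveI := Fact.mk hp
  have hp2 := hp.two_le
  have hq4 : 25 ≤ q ^ 2 := by
    have : 5 ≤ q := by omega
    nlinarith
  haveI : Fact (1 < q ^ 2) := ⟨by omega⟩
  have h1 : (2 : ZMod (q ^ 2)) ^ p = 1 := by
    have h := (ZMod.natCast_eq_zero_iff (2 ^ p - 1) (q ^ 2)).2 hdvd
    rw [Nat.cast_sub Nat.one_le_two_pow] at h
    push_cast at h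
    exact sub_eq_zero.1 h
  have h2 : (2 : ZMod (q ^ 2)) ≠ 1 := by
    intro h
    have h0 : (1 : ZMod (q ^ 2)) = 0 := by linear_combination h
    exact one_ne_zero h0
  have h3 : orderOf (2 : ZMod (q ^ 2)) = p := orderOf_eq_prime h1 h2
  have h4 : orderOf (-1 : ZMod (q ^ 2)) = 2 := by
    rw [orderOf_neg_one, ZMod.ringChar_zmod_n, if_neg (by omega)]
  have h5 := (Commute.all (-1 : ZMod (q ^ 2)) 2).orderOf_mul_eq_mul_orderOf_of_coprime
    (by rw [h3, h4]; exact (Nat.coprime_primes Nat.prime_two hp).2 (by omega))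
  rw [h3, h4, neg_one_mul] at h5
  exact h5
end

section
/- Let p be a prime number with p ≡ 3 (mod 4) such that q = 2p + 1 is also prime. If q² divides 2^p − 1, then 4^q ≡ 4 (mod q²), and hence the element (−2)^(q−2) of (ℤ/q²ℤ)* equals −2^(−1) (the negative of the inverse of 2 modulo q²) and has multiplicative order 2p, so it does not generate (ℤ/q²ℤ)*, a group of order 2pq. -/
/-- Let `p ≡ 3 (mod 4)` be a Sophie Germain prime and `q = 2p+1`. If `q^2 ∣ 2^p - 1`,
then `4^q ≡ 4 (mod q^2)`; hence `(-2)^(q-2)` equals `-2⁻¹` in `ZMod (q^2)` and has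
multiplicative order `2p`, so it does not generate `(ℤ/q²ℤ)*`, a group of order `2pq`. -/
theorem stmt14 (p q : ℕ) (hp : p.Prime) (hp4 : p % 4 = 3) (hq : q = 2 * p + 1)
    (hqprime : q.Prime) (hdvd : q ^ 2 ∣ 2 ^ p - 1) :
    4 ^ q ≡ 4 [MOD q ^ 2] ∧
      (-2 : ZMod (q ^ 2)) ^ (q - 2) = -(2 : ZMod (q ^ 2))⁻¹ ∧
      orderOf ((-2 : ZMod (q ^ 2)) ^ (q - 2)) = 2 * p ∧
      Nat.card (ZMod (q ^ 2))ˣ = 2 * p * q ∧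
      orderOf ((-2 : ZMod (q ^ 2)) ^ (q - 2)) ≠ 2 * p * q := by
  have hp3 : 3 ≤ p := by omega
  have hqq : 49 ≤ q ^ 2 := by
    have : 7 ≤ q := by omega
    nlinarith
  have hsmall : ∀ k : ℕ, 0 < k → k < 49 → ((k : ℕ) : ZMod (q ^ 2)) ≠ 0 := by
    intro k hk hk' h
    rw [ZMod.natCast_eq_zero_iff] at h
    have := Nat.le_of_dvd hk h
    omega
  have h2 : (2 : ZMod (q ^ 2)) ^ p = 1 := by
    have h := (ZMod.natCast_eq_zero_iff _ _).mpr hdvd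
    rw [Nat.cast_sub Nat.one_le_two_pow] at h
    push_cast at h
    exact sub_eq_zero.mp h
  have hodd : Odd p := Nat.odd_iff.mpr (by omega)
  have hn2 : (-2 : ZMod (q ^ 2)) ^ p = -1 := by
    rw [hodd.neg_pow, h2]
  obtain ⟨m, hm⟩ : ∃ m, q - 2 = m := ⟨_, rfl⟩
  have hm1 : m + 1 = p * 2 := by omega
  have hmodd : Odd m := Nat.odd_iff.mpr (by omega)
  have hx : (-2 : ZMod (q ^ 2)) ^ m * (-2) = 1 := by
    rw [← pow_succ, hm1, pow_mul, hn2]; norm_num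
  have hinv : (2 : ZMod (q ^ 2))⁻¹ = 2 ^ m :=
    ZMod.inv_eq_of_mul_eq_one _ _ _ (by
      rw [← pow_succ', hm1, pow_mul, h2, one_pow])
  have hord : orderOf ((-2 : ZMod (q ^ 2)) ^ m) = 2 * p := by
    apply orderOf_eq_of_pow_and_pow_div_prime (by omega)
    · rw [← pow_mul, show m * (2 * p) = p * (2 * m) by ring, pow_mul, hn2, pow_mul]
      norm_num
    · intro r hr hrd h
      rcases (Nat.Prime.dvd_mul hr).mp hrd with h' | h'
      · have hr2 : r = 2 := (Nat.prime_dvd_prime_iff_eq hr Nat.prime_two).mp h'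
        rw [hr2, Nat.mul_div_cancel_left _ (by norm_num), ← pow_mul, mul_comm, pow_mul, hn2,
          hmodd.neg_one_pow] at h
        apply hsmall 2 (by norm_num) (by norm_num)
        push_cast
        linear_combination -h
      · have hrp : r = p := (Nat.prime_dvd_prime_iff_eq hr hp).mp h'
        rw [hrp, Nat.mul_div_cancel _ hp.pos] at h
        apply hsmall 3 (by norm_num) (by norm_num)
        push_cast
        linear_combination (-4) * h + ((-2 : ZMod (q ^ 2)) ^ m * (-2) + 1) * hx
  rw [hm]
  refine ⟨?_, ?_, hord, ?_, ?_⟩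
  · rw [← ZMod.natCast_eq_natCast_iff]
    push_cast
    have h4 : (4 : ZMod (q ^ 2)) ^ p = 1 := by
      rw [show (4 : ZMod (q ^ 2)) = 2 * 2 by norm_num, mul_pow, h2, one_mul]
    have h5 : (4 : ZMod (q ^ 2)) ^ (p * 2 + 1) = 4 := by
      rw [pow_succ (4 : ZMod (q ^ 2)) (p * 2), pow_mul, h4, one_pow, one_mul]
    have h6 : p * 2 + 1 = q := by omega
    rwa [h6] at h5
  · rw [hinv, hmodd.neg_pow]
  · have : NeZero (q ^ 2) := ⟨by omega⟩
    rw [Nat.card_eq_fintype_card, ZMod.card_units_eq_totient, Nat.totient_prime_pow hqprime (by norm_num)]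
    have : q - 1 = 2 * p := by omega
    rw [this]; norm_num; ring
  · rw [hord]
    have : 7 ≤ q := by omega
    intro h
    nlinarith
end
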